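/- Let K₁ and K₂ be real 2n×2n matrices with K₁ Δ K₁ᵀ = K₂ Δ K₂ᵀ, and let α be a real symmetric 2n×2n matrix. Then the pair (K₁,α) satisfies the positivity condition if and only if the pair (K₂,α) satisfies the positivity condition. -/

import Mathlib

open Matrix Complex
open scoped ComplexOrder

/-- The standard symplectic form on `2*n` modes: block-diagonal with
`n` copies of `[[0,1],[-1,0]]`. -/
noncomputable def SympForm (n : ℕ) : Matrix (Fin (2*n)) (Fin (2*n)) ℝ :=
  Matrix.of fun i j =>
    if (i : ℕ) + 1 = (j : ℕ) ∧ (i : ℕ) % 2 = 0 then 1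
    else if (j : ℕ) + 1 = (i : ℕ) ∧ (j : ℕ) % 2 = 0 then -1 else 0

/-- Total transposition: block-diagonal with `n` copies of `diag(1,-1)`. -/
noncomputable def Transp (n : ℕ) : Matrix (Fin (2*n)) (Fin (2*n)) ℝ :=
  Matrix.diagonal fun i => if (i : ℕ) % 2 = 0 then 1 else -1

/-- `σ ≥ ± iΔ` : both `σ + iΔ` and `σ - iΔ` (as complex matrices) are PSD. -/
noncomputable def GeqPMiDelta {n : ℕ} (σ : Matrix (Fin (2*n)) (Fin (2*n)) ℝ) : Prop :=
  (σ.map (Complex.ofReal) + Complex.I • (SympForm n).map (Complex.ofReal)).PosSemidef ∧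
  (σ.map (Complex.ofReal) - Complex.I • (SympForm n).map (Complex.ofReal)).PosSemidef

/-- A quantum covariance matrix: real symmetric with `σ ≥ ± iΔ`. -/
noncomputable def IsQCM {n : ℕ} (σ : Matrix (Fin (2*n)) (Fin (2*n)) ℝ) : Prop :=
  σ.IsSymm ∧ GeqPMiDelta σ

/-- The positivity condition: `K σ Kᵀ + α ≥ ± iΔ` for every quantum covariance matrix `σ`. -/
noncomputable def PosCond {n : ℕ} (K α : Matrix (Fin (2*n)) (Fin (2*n)) ℝ) : Prop :=
  ∀ σ : Matrix (Fin (2*n)) (Fin (2*n)) ℝ, IsQCM σ → GeqPMiDelta (K * σ * Kᵀ + α)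

theorem dotProduct_mulVec_antisymm {ι : Type*} [Fintype ι] {D : Matrix ι ι ℝ}
    (hD : Dᵀ = -D) (x y : ι → ℝ) :
    y ⬝ᵥ D *ᵥ x = -(x ⬝ᵥ D *ᵥ y) := by
  rw [dotProduct_mulVec, ← mulVec_transpose, hD, dotProduct_comm, neg_mulVec, dotProduct_neg]

/-- For symmetric `σ` and antisymmetric `D`, positivity of `σ + iD` in real terms. -/
theorem posSemidef_ofReal_add_I_smul_iff {ι : Type*} [Fintype ι] {σ D : Matrix ι ι ℝ}
    (hσ : σ.IsSymm) (hD : Dᵀ = -D) :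
    (σ.map Complex.ofReal + Complex.I • D.map Complex.ofReal).PosSemidef ↔
      ∀ x y : ι → ℝ, 2 * (x ⬝ᵥ D *ᵥ y) ≤ x ⬝ᵥ σ *ᵥ x + y ⬝ᵥ σ *ᵥ y := by
  have herm : (σ.map Complex.ofReal + Complex.I • D.map Complex.ofReal).IsHermitian := by
    ext i j
    have h1 : σ j i = σ i j := hσ.apply i j
    have h2 : D j i = -D i j := congrFun (congrFun hD i) j
    simp [h1, h2]
  have symm : ∀ x y : ι → ℝ, y ⬝ᵥ σ *ᵥ x = x ⬝ᵥ σ *ᵥ y := fun x y => by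
    rw [dotProduct_mulVec, ← mulVec_transpose, hσ, dotProduct_comm]
  have cast_form : ∀ (M : Matrix ι ι ℝ) (x y : ι → ℝ),
      (fun i => (x i : ℂ)) ⬝ᵥ M.map Complex.ofReal *ᵥ (fun i => (y i : ℂ)) =
        ((x ⬝ᵥ M *ᵥ y : ℝ) : ℂ) := fun M x y => by
    simp [dotProduct, mulVec]
  have key : ∀ x y : ι → ℝ,
      star ((fun i => (x i : ℂ)) + Complex.I • (fun i => (y i : ℂ))) ⬝ᵥ
        (σ.map Complex.ofReal + Complex.I • D.map Complex.ofReal) *ᵥ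
          ((fun i => (x i : ℂ)) + Complex.I • (fun i => (y i : ℂ))) =
        ((x ⬝ᵥ σ *ᵥ x + y ⬝ᵥ σ *ᵥ y - 2 * (x ⬝ᵥ D *ᵥ y) : ℝ) : ℂ) := fun x y => by
    have hs : star ((fun i => (x i : ℂ)) + Complex.I • (fun i => (y i : ℂ))) =
        (fun i => (x i : ℂ)) - Complex.I • (fun i => (y i : ℂ)) := by
      ext i; simp [sub_eq_add_neg]
    have hx : x ⬝ᵥ D *ᵥ x = 0 := by linarith [dotProduct_mulVec_antisymm hD x x]
    have hy : y ⬝ᵥ D *ᵥ y = 0 := by linarith [dotProduct_mulVec_antisymm hD y y]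
    rw [hs]
    simp only [add_mulVec, mulVec_add, smul_mulVec, mulVec_smul, sub_dotProduct, dotProduct_add,
      smul_dotProduct, dotProduct_smul, cast_form, smul_eq_mul, hx, hy,
      dotProduct_mulVec_antisymm hD x y, symm x y]
    push_cast
    linear_combination
      (2 * ((x ⬝ᵥ D *ᵥ y : ℝ) : ℂ) - ((y ⬝ᵥ σ *ᵥ y : ℝ) : ℂ)) * Complex.I_mul_I
  rw [posSemidef_iff_dotProduct_mulVec]
  constructor
  · rintro ⟨-, h⟩ x y
    have := h ((fun i => (x i : ℂ)) + Complex.I • (fun i => (y i : ℂ)))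
    rw [key, Complex.zero_le_real] at this
    linarith
  · refine fun h => ⟨herm, fun z => ?_⟩
    have hz : z = (fun i => ((z i).re : ℂ)) + Complex.I • (fun i => ((z i).im : ℂ)) := by
      ext i
      simp [mul_comm Complex.I, Complex.re_add_im]
    rw [hz, key, Complex.zero_le_real]
    linarith [h (fun i => (z i).re) (fun i => (z i).im)]

theorem dotProduct_transpose_mul_self_mulVec {ι : Type*} [Fintype ι] (P : Matrix ι ι ℝ)
    (u : ι → ℝ) : u ⬝ᵥ (Pᵀ * P) *ᵥ u = P *ᵥ u ⬝ᵥ P *ᵥ u := by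
  rw [← mulVec_mulVec, dotProduct_mulVec, vecMul_transpose]

theorem dotProduct_vecMulVec_self_mulVec {ι : Type*} [Fintype ι] (w u : ι → ℝ) :
    u ⬝ᵥ vecMulVec w w *ᵥ u = (w ⬝ᵥ u) ^ 2 := by
  rw [vecMulVec_mulVec]
  simp [dotProduct_comm u w, sq]

/-- A weighted bound for a bilinear form on a finite-dimensional real space. -/
theorem exists_two_mul_bilin_le {ι : Type*} [Fintype ι] (D : Matrix ι ι ℝ) :
    ∃ C : ℝ, 0 ≤ C ∧ ∀ s : ℝ, 0 < s → ∀ u v : ι → ℝ,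
      2 * (u ⬝ᵥ D *ᵥ v) ≤ C * (s * (u ⬝ᵥ u) + s⁻¹ * (v ⬝ᵥ v)) := by
  refine ⟨∑ i, ∑ j, |D i j|, by positivity, fun s hs u v => ?_⟩
  have hle : ∀ (w : ι → ℝ) i, w i ^ 2 ≤ w ⬝ᵥ w := fun w i => by
    rw [sq]
    exact Finset.single_le_sum (f := fun i => w i * w i)
      (fun i _ => mul_self_nonneg _) (Finset.mem_univ i)
  simp only [dotProduct, mulVec, Finset.mul_sum, Finset.sum_mul] at hle ⊢
  simp only [← Finset.mul_sum, ← Finset.sum_mul]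
  rw [Finset.mul_sum, Finset.sum_mul]
  refine Finset.sum_le_sum fun i _ => ?_
  rw [Finset.mul_sum, Finset.mul_sum, Finset.sum_mul]
  refine Finset.sum_le_sum fun j _ => ?_
  have hs' : 0 < s⁻¹ := inv_pos.mpr hs
  have amgm : 2 * (|u i| * |v j|) ≤ s * u i ^ 2 + s⁻¹ * v j ^ 2 := by
    have h : s * u i ^ 2 + s⁻¹ * v j ^ 2 - 2 * (|u i| * |v j|) =
        s * (|u i| - s⁻¹ * |v j|) ^ 2 := by
      rw [← sq_abs (u i), ← sq_abs (v j)]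
      field_simp
      ring
    have : 0 ≤ s * (|u i| - s⁻¹ * |v j|) ^ 2 := by positivity
    linarith
  calc 2 * (u i * (D i j * v j)) ≤ |2 * (u i * (D i j * v j))| := le_abs_self _
    _ = |D i j| * (2 * (|u i| * |v j|)) := by
      simp only [abs_mul, abs_two]; ring
    _ ≤ _ := by
      refine mul_le_mul_of_nonneg_left (amgm.trans ?_) (abs_nonneg _)
      exact add_le_add (mul_le_mul_of_nonneg_left (hle u i) hs.le)
        (mul_le_mul_of_nonneg_left (hle v j) hs'.le)

theorem exists_matrix_projection_span_pair {ι : Type*} [Fintype ι] [DecidableEq ι]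
    (a b : ι → ℝ) :
    ∃ Q : Matrix ι ι ℝ, Q *ᵥ a = a ∧ Q *ᵥ b = b ∧
      ∀ v, ∃ p q : ℝ, p • a + q • b = Q *ᵥ v := by
  obtain ⟨f, hf⟩ := (LinearMap.id : Submodule.span ℝ {a, b} →ₗ[ℝ] _).exists_extend
  have hfix : ∀ w (hw : w ∈ Submodule.span ℝ {a, b}), (f w : ι → ℝ) = w := fun w hw =>
    congrArg Subtype.val (LinearMap.congr_fun hf ⟨w, hw⟩)
  have hQ : ∀ v, LinearMap.toMatrix' ((Submodule.subtype _).comp f) *ᵥ v = f v := fun v => by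
    rw [← Matrix.toLin'_apply, Matrix.toLin'_toMatrix']; rfl
  refine ⟨LinearMap.toMatrix' ((Submodule.subtype _).comp f), ?_, ?_, fun v => ?_⟩
  · rw [hQ, hfix a (Submodule.subset_span (by simp))]
  · rw [hQ, hfix b (Submodule.subset_span (by simp))]
  · rw [hQ]
    exact Submodule.mem_span_pair.mp (f v).2

section Antisymmetric

variable {ι : Type*} [Fintype ι] {D : Matrix ι ι ℝ}

theorem exists_dominating_of_pos [DecidableEq ι] (hD : Dᵀ = -D) (a b : ι → ℝ)
    (hc : 0 < a ⬝ᵥ D *ᵥ b) :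
    ∃ σ : Matrix ι ι ℝ, σ.IsSymm ∧
      (∀ u v, 2 * (u ⬝ᵥ D *ᵥ v) ≤ u ⬝ᵥ σ *ᵥ u + v ⬝ᵥ σ *ᵥ v) ∧
      a ⬝ᵥ σ *ᵥ a + b ⬝ᵥ σ *ᵥ b = 2 * (a ⬝ᵥ D *ᵥ b) := by
  obtain ⟨C, -, hC⟩ := exists_two_mul_bilin_le D
  obtain ⟨Q, hQa, hQb, hQ⟩ : ∃ Q : Matrix ι ι ℝ, Q *ᵥ a = a ∧ Q *ᵥ b = b ∧ ∀ v, Q *ᵥ v =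
      ((a ⬝ᵥ D *ᵥ b)⁻¹ * (D *ᵥ b ⬝ᵥ v)) • a - ((a ⬝ᵥ D *ᵥ b)⁻¹ * (D *ᵥ a ⬝ᵥ v)) • b := by
    have hQ : ∀ v, ((a ⬝ᵥ D *ᵥ b)⁻¹ • (vecMulVec a (D *ᵥ b) - vecMulVec b (D *ᵥ a))) *ᵥ v =
      ((a ⬝ᵥ D *ᵥ b)⁻¹ * (D *ᵥ b ⬝ᵥ v)) • a - ((a ⬝ᵥ D *ᵥ b)⁻¹ * (D *ᵥ a ⬝ᵥ v)) • b := by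
      intro v
      rw [smul_mulVec, sub_mulVec, vecMulVec_mulVec, vecMulVec_mulVec]
      ext i
      simp
      ring
    have haa : D *ᵥ a ⬝ᵥ a = 0 := by
      rw [dotProduct_comm]; linarith [dotProduct_mulVec_antisymm hD a a]
    have hbb : D *ᵥ b ⬝ᵥ b = 0 := by
      rw [dotProduct_comm]; linarith [dotProduct_mulVec_antisymm hD b b]
    have hba : D *ᵥ a ⬝ᵥ b = -(a ⬝ᵥ D *ᵥ b) := by
      rw [dotProduct_comm, dotProduct_mulVec_antisymm hD]
    refine ⟨_, ?_, ?_, hQ⟩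
    · rw [hQ, haa, dotProduct_comm _ a, inv_mul_cancel₀ hc.ne']; simp
    · rw [hQ, hbb, hba, mul_neg, inv_mul_cancel₀ hc.ne']; simp
  have form : ∀ u, u ⬝ᵥ ((a ⬝ᵥ D *ᵥ b)⁻¹ • (vecMulVec (D *ᵥ b) (D *ᵥ b) +
      vecMulVec (D *ᵥ a) (D *ᵥ a)) + C • ((1 - Q)ᵀ * (1 - Q))) *ᵥ u =
      (a ⬝ᵥ D *ᵥ b)⁻¹ * ((D *ᵥ b ⬝ᵥ u) ^ 2 + (D *ᵥ a ⬝ᵥ u) ^ 2) +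
        C * ((u - Q *ᵥ u) ⬝ᵥ (u - Q *ᵥ u)) := fun u => by
    simp only [add_mulVec, smul_mulVec, dotProduct_add, dotProduct_smul,
      dotProduct_vecMulVec_self_mulVec, dotProduct_transpose_mul_self_mulVec, smul_eq_mul,
      sub_mulVec, one_mulVec]
  refine ⟨(a ⬝ᵥ D *ᵥ b)⁻¹ • (vecMulVec (D *ᵥ b) (D *ᵥ b) +
      vecMulVec (D *ᵥ a) (D *ᵥ a)) + C • ((1 - Q)ᵀ * (1 - Q)), ?_, fun u v => ?_, ?_⟩
  · simp [IsSymm, transpose_vecMulVec]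
  · rw [form, form]
    have h := hC 1 one_pos (u - Q *ᵥ u) (v - Q *ᵥ v)
    have eq1 : u ⬝ᵥ D *ᵥ v = (u - Q *ᵥ u) ⬝ᵥ D *ᵥ (v - Q *ᵥ v) +
        (a ⬝ᵥ D *ᵥ b)⁻¹ * ((D *ᵥ a ⬝ᵥ u) * (D *ᵥ b ⬝ᵥ v) -
          (D *ᵥ b ⬝ᵥ u) * (D *ᵥ a ⬝ᵥ v)) := by
      have haa : a ⬝ᵥ D *ᵥ a = 0 := by linarith [dotProduct_mulVec_antisymm hD a a]
      have hbb : b ⬝ᵥ D *ᵥ b = 0 := by linarith [dotProduct_mulVec_antisymm hD b b]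
      rw [hQ u, hQ v]
      simp only [mulVec_sub, mulVec_smul, sub_dotProduct, dotProduct_sub, smul_dotProduct,
        dotProduct_smul, smul_eq_mul, haa, hbb, dotProduct_mulVec_antisymm hD a b,
        dotProduct_mulVec_antisymm hD v a, dotProduct_mulVec_antisymm hD v b,
        dotProduct_comm (D *ᵥ a), dotProduct_comm (D *ᵥ b)]
      field_simp
      ring
    have h2 : 0 ≤ (a ⬝ᵥ D *ᵥ b)⁻¹ * ((D *ᵥ a ⬝ᵥ u - D *ᵥ b ⬝ᵥ v) ^ 2 +
      (D *ᵥ b ⬝ᵥ u + D *ᵥ a ⬝ᵥ v) ^ 2) := by positivity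
    rw [eq1]
    linarith
  · rw [form, form, hQa, hQb]
    have haa : D *ᵥ a ⬝ᵥ a = 0 := by
      rw [dotProduct_comm]; linarith [dotProduct_mulVec_antisymm hD a a]
    have hbb : D *ᵥ b ⬝ᵥ b = 0 := by
      rw [dotProduct_comm]; linarith [dotProduct_mulVec_antisymm hD b b]
    have hba : D *ᵥ a ⬝ᵥ b = -(a ⬝ᵥ D *ᵥ b) := by
      rw [dotProduct_comm, dotProduct_mulVec_antisymm hD]
    rw [haa, hbb, hba, dotProduct_comm _ a]
    simp only [sub_self, dotProduct_zero]
    field_simp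
    ring

theorem exists_dominating_of_isotropic [DecidableEq ι] (hD : Dᵀ = -D) (a b : ι → ℝ)
    (hc : a ⬝ᵥ D *ᵥ b = 0) {ε : ℝ} (hε : 0 < ε) :
    ∃ σ : Matrix ι ι ℝ, σ.IsSymm ∧
      (∀ u v, 2 * (u ⬝ᵥ D *ᵥ v) ≤ u ⬝ᵥ σ *ᵥ u + v ⬝ᵥ σ *ᵥ v) ∧
      a ⬝ᵥ σ *ᵥ a + b ⬝ᵥ σ *ᵥ b ≤ ε := by
  obtain ⟨C, hC0, hC⟩ := exists_two_mul_bilin_le D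
  obtain ⟨Q, hQa, hQb, hQ⟩ := exists_matrix_projection_span_pair a b
  have hiso : ∀ u v, Q *ᵥ u ⬝ᵥ D *ᵥ (Q *ᵥ v) = 0 := fun u v => by
    obtain ⟨p, q, h1⟩ := hQ u
    obtain ⟨p', q', h2⟩ := hQ v
    have haa : a ⬝ᵥ D *ᵥ a = 0 := by linarith [dotProduct_mulVec_antisymm hD a a]
    have hbb : b ⬝ᵥ D *ᵥ b = 0 := by linarith [dotProduct_mulVec_antisymm hD b b]
    simp [← h1, ← h2, mulVec_add, mulVec_smul, haa, hbb, dotProduct_mulVec_antisymm hD a b, hc]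
  have hN : 0 ≤ C * (a ⬝ᵥ a + b ⬝ᵥ b) := mul_nonneg hC0 (add_nonneg
    (Finset.sum_nonneg fun i _ => mul_self_nonneg _)
    (Finset.sum_nonneg fun i _ => mul_self_nonneg _))
  set t : ℝ := ε / (C * (a ⬝ᵥ a + b ⬝ᵥ b) + 1) with ht
  have ht0 : 0 < t := by positivity
  have form : ∀ u, u ⬝ᵥ (C • (t • (Qᵀ * Q) + (t⁻¹ + 1) • ((1 - Q)ᵀ * (1 - Q)))) *ᵥ u =
      C * (t * (Q *ᵥ u ⬝ᵥ Q *ᵥ u) + (t⁻¹ + 1) * ((u - Q *ᵥ u) ⬝ᵥ (u - Q *ᵥ u))) := fun u => by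
    simp only [add_mulVec, smul_mulVec, dotProduct_add, dotProduct_smul,
      dotProduct_transpose_mul_self_mulVec, smul_eq_mul, sub_mulVec, one_mulVec]
  refine ⟨C • (t • (Qᵀ * Q) + (t⁻¹ + 1) • ((1 - Q)ᵀ * (1 - Q))), ?_, fun u v => ?_, ?_⟩
  · simp [IsSymm]
  · rw [form, form]
    have h1 := hC t ht0 (Q *ᵥ u) (v - Q *ᵥ v)
    have h2 := hC t⁻¹ (inv_pos.mpr ht0) (u - Q *ᵥ u) (Q *ᵥ v)
    have h3 := hC 1 one_pos (u - Q *ᵥ u) (v - Q *ᵥ v)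
    have split : u ⬝ᵥ D *ᵥ v = Q *ᵥ u ⬝ᵥ D *ᵥ (Q *ᵥ v) + Q *ᵥ u ⬝ᵥ D *ᵥ (v - Q *ᵥ v) +
        (u - Q *ᵥ u) ⬝ᵥ D *ᵥ (Q *ᵥ v) + (u - Q *ᵥ u) ⬝ᵥ D *ᵥ (v - Q *ᵥ v) := by
      simp only [mulVec_sub, sub_dotProduct, dotProduct_sub]
      ring
    rw [inv_inv] at h2
    rw [split, hiso]
    linarith
  · rw [form, form, hQa, hQb]
    have : t * (C * (a ⬝ᵥ a + b ⬝ᵥ b) + 1) = ε := by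
      rw [ht]; field_simp
    simp only [sub_self, dotProduct_zero]
    linarith

theorem exists_dominating_le [DecidableEq ι] (hD : Dᵀ = -D) (a b : ι → ℝ)
    {ε : ℝ} (hε : 0 < ε) :
    ∃ σ : Matrix ι ι ℝ, σ.IsSymm ∧
      (∀ u v, 2 * (u ⬝ᵥ D *ᵥ v) ≤ u ⬝ᵥ σ *ᵥ u + v ⬝ᵥ σ *ᵥ v) ∧
      a ⬝ᵥ σ *ᵥ a + b ⬝ᵥ σ *ᵥ b ≤ 2 * |a ⬝ᵥ D *ᵥ b| + ε := by
  rcases lt_trichotomy (a ⬝ᵥ D *ᵥ b) 0 with hc | hc | hc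
  · obtain ⟨σ, h1, h2, h3⟩ := exists_dominating_of_pos hD a (-b) (by simpa [mulVec_neg] using hc)
    refine ⟨σ, h1, h2, ?_⟩
    simp only [mulVec_neg, dotProduct_neg, neg_dotProduct, neg_neg] at h3
    rw [h3, abs_of_neg hc]
    linarith
  · obtain ⟨σ, h1, h2, h3⟩ := exists_dominating_of_isotropic hD a b hc hε
    exact ⟨σ, h1, h2, by simpa [hc] using h3⟩
  · obtain ⟨σ, h1, h2, h3⟩ := exists_dominating_of_pos hD a b hc
    refine ⟨σ, h1, h2, ?_⟩
    rw [h3, abs_of_pos hc]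
    linarith

end Antisymmetric

theorem sympForm_transpose (n : ℕ) : (SympForm n)ᵀ = -SympForm n := by
  ext i j
  simp only [SympForm, transpose_apply, of_apply, Matrix.neg_apply]
  split_ifs <;> first | omega | simp

theorem geqPMiDelta_iff {n : ℕ} {σ : Matrix (Fin (2 * n)) (Fin (2 * n)) ℝ} (hσ : σ.IsSymm) :
    GeqPMiDelta σ ↔
      ∀ x y, 2 * (x ⬝ᵥ SympForm n *ᵥ y) ≤ x ⬝ᵥ σ *ᵥ x + y ⬝ᵥ σ *ᵥ y := by
  have hneg : σ.map Complex.ofReal - Complex.I • (SympForm n).map Complex.ofReal =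
      σ.map Complex.ofReal + Complex.I • (-SympForm n).map Complex.ofReal := by
    ext i j
    simp [sub_eq_add_neg]
  rw [GeqPMiDelta, hneg, posSemidef_ofReal_add_I_smul_iff hσ (sympForm_transpose n),
    posSemidef_ofReal_add_I_smul_iff hσ (by rw [transpose_neg, sympForm_transpose])]
  refine ⟨And.left, fun h => ⟨h, fun x y => ?_⟩⟩
  simpa [mulVec_neg, neg_mulVec] using h x (-y)

theorem dotProduct_conj_mulVec {ι : Type*} [Fintype ι] (K M : Matrix ι ι ℝ) (x y : ι → ℝ) :
    x ⬝ᵥ (K * M * Kᵀ) *ᵥ y = (Kᵀ *ᵥ x) ⬝ᵥ M *ᵥ (Kᵀ *ᵥ y) := by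
  rw [← mulVec_mulVec, ← mulVec_mulVec, dotProduct_mulVec, mulVec_transpose K x]

/-- The positivity condition depends on `K` only through `K Δ Kᵀ`. -/
theorem posCond_iff {n : ℕ} {K α : Matrix (Fin (2 * n)) (Fin (2 * n)) ℝ} (hα : α.IsSymm) :
    PosCond K α ↔ ∀ x y, 2 * (x ⬝ᵥ SympForm n *ᵥ y) ≤
      2 * |x ⬝ᵥ (K * SympForm n * Kᵀ) *ᵥ y| + (x ⬝ᵥ α *ᵥ x + y ⬝ᵥ α *ᵥ y) := by
  have hsymm : ∀ σ : Matrix (Fin (2 * n)) (Fin (2 * n)) ℝ, σ.IsSymm →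
      (K * σ * Kᵀ + α).IsSymm := fun σ hσ => by
    simp [IsSymm, transpose_mul, hσ.eq, hα.eq, Matrix.mul_assoc]
  constructor
  · intro h x y
    refine le_of_forall_pos_le_add fun ε hε => ?_
    obtain ⟨σ, h1, h2, h3⟩ :=
      exists_dominating_le (sympForm_transpose n) (Kᵀ *ᵥ x) (Kᵀ *ᵥ y) hε
    have h4 := (geqPMiDelta_iff (hsymm σ h1)).mp (h σ ⟨h1, (geqPMiDelta_iff h1).mpr h2⟩) x y
    simp only [add_mulVec, dotProduct_add, dotProduct_conj_mulVec] at h4 ⊢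
    linarith
  · rintro h σ ⟨h1, h2⟩
    rw [geqPMiDelta_iff h1] at h2
    refine (geqPMiDelta_iff (hsymm σ h1)).mpr fun x y => ?_
    have h3 := h x y
    simp only [add_mulVec, dotProduct_add, dotProduct_conj_mulVec] at h3 ⊢
    have h4 := h2 (Kᵀ *ᵥ x) (Kᵀ *ᵥ y)
    have h5 := h2 (Kᵀ *ᵥ x) (-(Kᵀ *ᵥ y))
    simp only [mulVec_neg, dotProduct_neg, neg_dotProduct, neg_neg] at h5
    rcases abs_cases ((Kᵀ *ᵥ x) ⬝ᵥ SympForm n *ᵥ (Kᵀ *ᵥ y)) with ⟨h6, -⟩ | ⟨h6, -⟩ <;>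
      rw [h6] at h3 <;> linarith

/-- If `K₁ Δ K₁ᵀ = K₂ Δ K₂ᵀ`, then `(K₁, α)` satisfies the positivity condition
iff `(K₂, α)` does. -/
theorem stmt3 (n : ℕ) (hn : 0 < n) (K₁ K₂ α : Matrix (Fin (2*n)) (Fin (2*n)) ℝ)
    (hα : α.IsSymm) (hK : K₁ * SympForm n * K₁ᵀ = K₂ * SympForm n * K₂ᵀ) :
    PosCond K₁ α ↔ PosCond K₂ α := by
  rw [posCond_iff hα, posCond_iff hα, hK]
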